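/- arXiv:2307.13015 — 7 statements merged into one kernel-verified Lean document; each statement's English description precedes it below -/
import Mathlib

section
/- Let C_1, …, C_p ∈ ℝ^n be affinely independent points, let α_1, …, α_p > 0 with Σ_{k=1}^p α_k = 1 and C_0 = Σ_{k=1}^p α_k C_k, and let r > 0 and R ≥ 0. Then the system of equations ‖x − C_k‖² − r² − ‖x − C_0‖² = −R² (for k = 1, …, p) has a solution x ∈ ℝ^n if and only if R² = ‖C_0‖² + r² − Σ_{k=1}^p α_k ‖C_k‖². Moreover, in that case, the solution set equals x₀ + {C_p − C_1, …, C_p − C_{p−1}}^⊥ for any particular solution x₀, i.e., it is a coset of the orthogonal complement of span{C_p − C_1, …, C_p − C_{p−1}}. -/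
open scoped RealInnerProductSpace

section PowerDifference

variable {E ι : Type*} [NormedAddCommGroup E] [InnerProductSpace ℝ E]

/-- The difference of the squared distances to two points, expanded. -/
theorem norm_sub_sq_sub_norm_sub_sq (x a b : E) :
    ‖x - a‖ ^ 2 - ‖x - b‖ ^ 2 = 2 * ⟪b - a, x⟫ + ‖a‖ ^ 2 - ‖b‖ ^ 2 := by
  rw [norm_sub_sq_real, norm_sub_sq_real, inner_sub_left, real_inner_comm a x, real_inner_comm b x]
  ring

/-- The weighted mean of the differences of squared distances to the points `C k` and to their
barycenter does not depend on the base point. -/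
theorem sum_mul_norm_sub_sq_sub [Fintype ι] (C : ι → E) (α : ι → ℝ) (hsum : ∑ k, α k = 1) (x : E) :
    ∑ k, α k * (‖x - C k‖ ^ 2 - ‖x - ∑ i, α i • C i‖ ^ 2) =
      ∑ k, α k * ‖C k‖ ^ 2 - ‖∑ i, α i • C i‖ ^ 2 := by
  have hinner : ⟪∑ i, α i • C i, x⟫ = ∑ k, α k * ⟪C k, x⟫ := by
    simp [sum_inner, real_inner_smul_left]
  set C₀ := ∑ i, α i • C i
  have hterm (k : ι) : α k * (‖x - C k‖ ^ 2 - ‖x - C₀‖ ^ 2) =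
      α k * (2 * ⟪C₀, x⟫ - ‖C₀‖ ^ 2) - 2 * (α k * ⟪C k, x⟫) + α k * ‖C k‖ ^ 2 := by
    rw [norm_sub_sq_sub_norm_sub_sq, inner_sub_left]
    ring
  simp_rw [hterm]
  rw [Finset.sum_add_distrib, Finset.sum_sub_distrib, ← Finset.sum_mul, ← Finset.mul_sum, hsum,
    ← hinner]
  ring

/-- An affinely independent finite family lies on a sphere. -/
theorem AffineIndependent.exists_norm_sub_sq_eq [Fintype ι] [Nonempty ι] {C : ι → E}
    (hC : AffineIndependent ℝ C) : ∃ (x : E) (d : ℝ), ∀ k, ‖x - C k‖ ^ 2 = d := by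
  obtain ⟨s, ⟨-, hs⟩, -⟩ := hC.existsUnique_dist_eq
  refine ⟨s.center, s.radius ^ 2, fun k => ?_⟩
  rw [← dist_eq_norm, dist_comm, EuclideanGeometry.mem_sphere.1 (hs ⟨k, rfl⟩)]

end PowerDifference

/-- For affinely independent points `C 0, …, C p` (so `p + 1` points), positive convex
weights `α` with `C₀ = ∑ α k • C k`, `r > 0` and `R ≥ 0`, the system
`‖x − C k‖² − r² − ‖x − C₀‖² = −R²` (for all `k`) is solvable iff
`R² = ‖C₀‖² + r² − ∑ α k ‖C k‖²`, and the solution set is the coset of the orthogonal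
complement of `span {C_last − C k : k < last}` through any particular solution. -/
theorem stmt4 {n p : ℕ} (C : Fin (p + 1) → EuclideanSpace ℝ (Fin n))
    (hindep : AffineIndependent ℝ C)
    (α : Fin (p + 1) → ℝ) (hα : ∀ k, 0 < α k) (hsum : ∑ k, α k = 1)
    (C₀ : EuclideanSpace ℝ (Fin n)) (hrep : C₀ = ∑ k, α k • C k)
    (r R : ℝ) (hr : 0 < r) (hR : 0 ≤ R) :
    ((∃ x : EuclideanSpace ℝ (Fin n),
        ∀ k, ‖x - C k‖ ^ 2 - r ^ 2 - ‖x - C₀‖ ^ 2 = -R ^ 2) ↔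
      R ^ 2 = ‖C₀‖ ^ 2 + r ^ 2 - ∑ k, α k * ‖C k‖ ^ 2) ∧
    (∀ x₀ : EuclideanSpace ℝ (Fin n),
      (∀ k, ‖x₀ - C k‖ ^ 2 - r ^ 2 - ‖x₀ - C₀‖ ^ 2 = -R ^ 2) →
      {x : EuclideanSpace ℝ (Fin n) |
          ∀ k, ‖x - C k‖ ^ 2 - r ^ 2 - ‖x - C₀‖ ^ 2 = -R ^ 2} =
        {x : EuclideanSpace ℝ (Fin n) |
          ∀ j : Fin p, ⟪C (Fin.last p) - C j.castSucc, x - x₀⟫ = 0}) := by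
  subst hrep
  refine ⟨⟨?_, fun h => ?_⟩, fun x₀ hx₀ => ?_⟩
  · rintro ⟨x, hx⟩
    have hmean := sum_mul_norm_sub_sq_sub C α hsum x
    have hconst (k : Fin (p + 1)) :
        ‖x - C k‖ ^ 2 - ‖x - ∑ i, α i • C i‖ ^ 2 = r ^ 2 - R ^ 2 := by
      linarith [hx k]
    simp_rw [hconst] at hmean
    rw [← Finset.sum_mul, hsum] at hmean
    linarith
  · obtain ⟨x, d, hx⟩ := hindep.exists_norm_sub_sq_eq
    have hmean := sum_mul_norm_sub_sq_sub C α hsum x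
    simp_rw [hx] at hmean
    rw [← Finset.sum_mul, hsum] at hmean
    exact ⟨x, fun k => by rw [hx k]; linarith⟩
  · set C₀ := ∑ i, α i • C i with hC₀
    ext x
    simp only [Set.mem_ofPred_eq]
    have hdiff (k : Fin (p + 1)) :
        ‖x - C k‖ ^ 2 - r ^ 2 - ‖x - C₀‖ ^ 2 = -R ^ 2 ↔ ⟪C₀, x - x₀⟫ = ⟪C k, x - x₀⟫ := by
      have h := norm_sub_sq_sub_norm_sub_sq x (C k) C₀
      have h₀ := norm_sub_sq_sub_norm_sub_sq x₀ (C k) C₀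
      have hk := hx₀ k
      simp only [inner_sub_left, inner_sub_right] at h h₀ ⊢
      constructor <;> intro <;> linarith
    simp_rw [hdiff, inner_sub_left, sub_eq_zero]
    refine ⟨fun hx j => (hx _).symm.trans (hx _), fun hx => ?_⟩
    have hlast (k : Fin (p + 1)) : ⟪C k, x - x₀⟫ = ⟪C (Fin.last p), x - x₀⟫ :=
      Fin.lastCases rfl (fun j => (hx j).symm) k
    intro k
    rw [hlast k, hC₀, sum_inner]
    simp_rw [real_inner_smul_left, hlast]
    rw [← Finset.sum_mul, hsum, one_mul]
end

section
/- Let x*, C_1, …, C_{n+1} ∈ ℝ^n be pairwise distinct points and r > 0 such that: (1) x* ∉ conv{C_1, …, C_{n+1}}; (2) there exist α_1, …, α_n > 0 with C_{n+1} − x* = Σ_{k=1}^n α_k (C_k − x*); and (3) ‖x* − C_k‖ = r for all k ∈ {1, …, n+1}. Then x* is the unique maximizer of ‖x − C_{n+1}‖ over ⋂_{k=1}^n B̄(C_k, r): x* ∈ ⋂_{k=1}^n B̄(C_k, r), and every y ∈ ⋂_{k=1}^n B̄(C_k, r) with y ≠ x* satisfies ‖y − C_{n+1}‖ < ‖x*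 − C_{n+1}‖. -/
open Metric

section PositiveCombination

variable {ι E : Type*} [Fintype ι] [NormedAddCommGroup E] [InnerProductSpace ℝ E]
  {α : ι → ℝ} {v : ι → E} {w : E} {r : ℝ}

/-- If a nonzero vector is a positive combination of vectors of its own norm, all different
from it, then the coefficients sum to more than one. -/
theorem one_lt_sum_of_eq_sum_smul_of_norm_eq (hr : 0 < r) (hα : ∀ k, 0 < α k)
    (hw : ‖w‖ = r) (hv : ∀ k, ‖v k‖ = r) (hne : ∀ k, v k ≠ w) (hcomb : w = ∑ k, α k • v k) :
    1 < ∑ k, α k := by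
  have hι : (Finset.univ : Finset ι).Nonempty := by
    rw [Finset.nonempty_iff_ne_empty]
    intro h
    rw [h, Finset.sum_empty] at hcomb
    simp only [hcomb, norm_zero] at hw
    exact hr.ne hw
  have hpos : 0 < ∑ k, α k * ‖v k - w‖ ^ 2 :=
    Finset.sum_pos (fun k _ => mul_pos (hα k)
      (pow_pos (norm_pos_iff.2 (sub_ne_zero.2 (hne k))) 2)) hι
  have hinner : ∑ k, α k * inner ℝ (v k) w = r ^ 2 := by
    rw [← hw, ← real_inner_self_eq_norm_sq]
    conv_rhs => rw [hcomb, sum_inner, ← hcomb]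
    simp only [real_inner_smul_left]
  have hsum : ∑ k, α k * ‖v k - w‖ ^ 2 =
      2 * r ^ 2 * (∑ k, α k) - 2 * ∑ k, α k * inner ℝ (v k) w := by
    rw [Finset.mul_sum, Finset.mul_sum, ← Finset.sum_sub_distrib]
    refine Finset.sum_congr rfl fun k _ => ?_
    rw [norm_sub_sq_real, hv, hw]
    ring
  nlinarith [pow_pos hr 2]

/-- A nonzero `d` at distance at most `r` from vectors `v k` of norm `r` is at distance less
than `r` from every other vector of norm `r` that is a positive combination of the `v k`. -/
theorem norm_sub_lt_of_eq_sum_smul_of_norm_eq (hr : 0 < r) (hα : ∀ k, 0 < α k)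
    (hw : ‖w‖ = r) (hv : ∀ k, ‖v k‖ = r) (hne : ∀ k, v k ≠ w) (hcomb : w = ∑ k, α k • v k)
    {d : E} (hd : d ≠ 0) (hdv : ∀ k, ‖d - v k‖ ≤ r) : ‖d - w‖ < r := by
  have hα1 := one_lt_sum_of_eq_sum_smul_of_norm_eq hr hα hw hv hne hcomb
  have hd2 : 0 < ‖d‖ ^ 2 := pow_pos (norm_pos_iff.2 hd) 2
  have hinner : (∑ k, α k) * ‖d‖ ^ 2 ≤ 2 * inner ℝ d w := by
    rw [hcomb, inner_sum, Finset.sum_mul, Finset.mul_sum]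
    refine Finset.sum_le_sum fun k _ => ?_
    have hk := pow_le_pow_left₀ (norm_nonneg _) (hdv k) 2
    rw [norm_sub_sq_real, hv] at hk
    rw [real_inner_smul_right]
    nlinarith [hα k]
  refine lt_of_pow_lt_pow_left₀ 2 hr.le ?_
  rw [norm_sub_sq_real, hw]
  nlinarith

end PositiveCombination

/-- Lemma 4: if `x*` is outside the convex hull of `C 0, …, C n` (indexed by
`Fin (n+1)`, with `C (Fin.last n)` playing the role of `C_{n+1}`), the vector
`C_{n+1} − x*` is a strictly positive combination of the vectors `C k − x*`, and `x*` is
at distance exactly `r` from every `C k`, then `x*` is the unique maximizer of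
`‖x − C_{n+1}‖` over the intersection `⋂_{k=1}^n B̄(C k, r)`. -/
theorem stmt10 {n : ℕ} (x : EuclideanSpace ℝ (Fin n))
    (C : Fin (n + 1) → EuclideanSpace ℝ (Fin n)) (r : ℝ) (hr : 0 < r)
    (hCinj : Function.Injective C) (hxC : ∀ k, x ≠ C k)
    (hout : x ∉ convexHull ℝ (Set.range C))
    (α : Fin n → ℝ) (hα : ∀ k, 0 < α k)
    (hcomb : C (Fin.last n) - x = ∑ k : Fin n, α k • (C k.castSucc - x))
    (hdist : ∀ k, ‖x - C k‖ = r) :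
    x ∈ (⋂ k : Fin n, closedBall (C k.castSucc) r) ∧
    ∀ y ∈ ⋂ k : Fin n, closedBall (C k.castSucc) r, y ≠ x →
      ‖y - C (Fin.last n)‖ < ‖x - C (Fin.last n)‖ := by
  refine ⟨Set.mem_iInter.2 fun k => ?_, fun y hy hyx => ?_⟩
  · rw [mem_closedBall, dist_eq_norm, hdist]
  · rw [hdist, ← sub_sub_sub_cancel_right y _ x]
    refine norm_sub_lt_of_eq_sum_smul_of_norm_eq hr hα ?_ (fun k => ?_) (fun k => ?_) hcomb
      (sub_ne_zero.2 hyx) fun k => ?_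
    · rw [norm_sub_rev, hdist]
    · rw [norm_sub_rev, hdist]
    · exact fun h => Fin.castSucc_ne_last k (hCinj (sub_left_injective h))
    · rw [sub_sub_sub_cancel_right, ← dist_eq_norm]
      exact mem_closedBall.1 (Set.mem_iInter.1 hy k)
end

section
/- Let S ∈ ℝ^n, T ∈ ℝ, and β > 0. There exists x ∈ ℝ^n with 0 ≤ x_i ≤ 1 for all i, ⟨S, x⟩ ≤ T, and Σ_{i=1}^n x_i(x_i − 1) + β⟨S, x⟩ = βT if and only if there exists x ∈ {0,1}^n with ⟨S, x⟩ = T, i.e., if and only if the subset sum problem SSP(S, T) has a solution. -/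
open scoped RealInnerProductSpace

/-- The objective `∑ xᵢ (xᵢ − 1) + β ⟪S, x⟫` attains the value `β T` on the feasible set
`P = {x : ⟪S, x⟫ ≤ T, 0 ≤ xᵢ ≤ 1}` if and only if the subset sum problem `SSP(S, T)` has
a solution. -/
theorem stmt12 {n : ℕ} (S : EuclideanSpace ℝ (Fin n)) (T β : ℝ) (hβ : 0 < β) :
    (∃ x : EuclideanSpace ℝ (Fin n),
      (∀ i, 0 ≤ x i ∧ x i ≤ 1) ∧ ⟪S, x⟫ ≤ T ∧
      (∑ i, x i * (x i - 1)) + β * ⟪S, x⟫ = β * T) ↔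
    (∃ x : EuclideanSpace ℝ (Fin n),
      (∀ i, x i = 0 ∨ x i = 1) ∧ ⟪S, x⟫ = T) := by
  constructor
  · rintro ⟨x, hx, hle, heq⟩
    have hterm : ∀ i ∈ Finset.univ, x i * (x i - 1) ≤ 0 := fun i _ =>
      mul_nonpos_of_nonneg_of_nonpos (hx i).1 (sub_nonpos.2 (hx i).2)
    have hsum : ∑ i, x i * (x i - 1) ≤ 0 := Finset.sum_nonpos hterm
    have hmul : β * ⟪S, x⟫ ≤ β * T := mul_le_mul_of_nonneg_left hle hβ.le
    have hzero : ∑ i, x i * (x i - 1) = 0 := by linarith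
    refine ⟨x, fun i => ?_, mul_left_cancel₀ hβ.ne' (by linarith)⟩
    have hi := (Finset.sum_eq_zero_iff_of_nonpos hterm).1 hzero i (Finset.mem_univ i)
    exact (mul_eq_zero.1 hi).imp_right sub_eq_zero.1
  · rintro ⟨x, hx, heq⟩
    have hzero : ∑ i, x i * (x i - 1) = 0 := Finset.sum_eq_zero fun i _ => by
      rcases hx i with h | h <;> simp [h]
    refine ⟨x, fun i => ?_, heq.le, by rw [hzero, heq, zero_add]⟩
    rcases hx i with h | h <;> simp [h]
end

section
/- Let n ≥ 1, let C = (1/2, …, 1/2) ∈ ℝ^n, let e_k be the k-th standard basis vector, let d > 0, and let r > 0 satisfy r² = (d + 1/2)² + (n − 1)/4. Set C_{k+} = C + d·e_k and C_{k−} = C − d·e_k. Then for every x ∈ ℝ^n with ‖x − C‖ = √n/2 and every k ∈ {1,…,n}: ‖x − C_{k+}‖ ≤ r if and only if x_k ≥ 0, and ‖x − C_{k−}‖ ≤ r if and only if x_k ≤ 1. -/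
/-- The squared distance from `y` to the multiple `t • e_k` of a standard basis vector. -/
theorem EuclideanSpace.norm_sub_smul_single_sq {ι : Type*} [Fintype ι] [DecidableEq ι]
    (y : EuclideanSpace ℝ ι) (t : ℝ) (k : ι) :
    ‖y - t • EuclideanSpace.single k (1 : ℝ)‖ ^ 2 = ‖y‖ ^ 2 - 2 * t * y k + t ^ 2 := by
  rw [norm_sub_sq_real, inner_smul_right, EuclideanSpace.inner_single_right, norm_smul,
    PiLp.norm_single, mul_pow, Real.norm_eq_abs, sq_abs]
  simp
  ring

/-- With `C` the center of the unit hypercube, `C_{k±} = C ± d • e_k` and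
`r² = (d + 1/2)² + (n − 1)/4`, a point `x` of the sphere of center `C` and radius
`√n / 2` satisfies `‖x − C_{k+}‖ ≤ r` iff `x k ≥ 0`, and `‖x − C_{k−}‖ ≤ r` iff
`x k ≤ 1`. -/
theorem stmt13 {n : ℕ} (hn : 1 ≤ n) (C : EuclideanSpace ℝ (Fin n))
    (hC : ∀ i, C i = 1 / 2) (d r : ℝ) (hd : 0 < d) (hr : 0 < r)
    (hr2 : r ^ 2 = (d + 1 / 2) ^ 2 + ((n : ℝ) - 1) / 4) :
    ∀ x : EuclideanSpace ℝ (Fin n), ‖x - C‖ = Real.sqrt n / 2 →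
      ∀ k : Fin n,
        (‖x - (C + d • EuclideanSpace.single k 1)‖ ≤ r ↔ 0 ≤ x k) ∧
        (‖x - (C - d • EuclideanSpace.single k 1)‖ ≤ r ↔ x k ≤ 1) := by
  intro x hx k
  have hx2 : ‖x - C‖ ^ 2 = n / 4 := by
    rw [hx, div_pow, Real.sq_sqrt n.cast_nonneg]
    norm_num
  have hk : (x - C) k = x k - 1 / 2 := by simp [hC]
  have key (t : ℝ) : ‖x - (C + t • EuclideanSpace.single k 1)‖ ≤ r ↔
      t * (1 - 2 * x k) + t ^ 2 ≤ d + d ^ 2 := by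
    rw [← sq_le_sq₀ (norm_nonneg _) hr.le, ← sub_sub,
      EuclideanSpace.norm_sub_smul_single_sq, hx2, hk, hr2]
    constructor <;> intro h <;> linarith
  constructor
  · rw [key]
    constructor <;> intro h <;> nlinarith
  · rw [sub_eq_add_neg C, ← neg_smul, key]
    constructor <;> intro h <;> nlinarith
end

section
/- Let n ≥ 1, let C = (1/2, …, 1/2) ∈ ℝ^n, let d > 0, and let r > 0 satisfy r² = (d + 1/2)² + (n − 1)/4. Set C_{k+} = C + d·e_k, C_{k−} = C − d·e_k, and U_r = ⋂_{k=1}^n (B̄(C_{k+}, r) ∩ B̄(C_{k−}, r)). Then U_r and the unit hypercube [0,1]^n have the same intersection with the sphere {x : ‖x − C‖ = √n/2}: for every x with ‖x − C‖ = √n/2, x ∈ U_r if and only if 0 ≤ x_k ≤ 1 for all k. In particular, U_r has the same corners as the hypercube. -/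
open Metric

/-- If `y` lies on the sphere of radius `√n / 2`, then its translate by `-c • eₖ` has norm at most
`r` exactly when `-2 c yₖ ≤ |c|`, where `r ^ 2 = (|c| + 1 / 2) ^ 2 + (n - 1) / 4`. -/
theorem norm_sub_smul_single_le_iff {n : ℕ} {y : EuclideanSpace ℝ (Fin n)}
    (hy : ‖y‖ = Real.sqrt n / 2) (k : Fin n) {c r : ℝ} (hr : 0 ≤ r)
    (hr2 : r ^ 2 = (|c| + 1 / 2) ^ 2 + ((n : ℝ) - 1) / 4) :
    ‖y - c • EuclideanSpace.single k (1 : ℝ)‖ ≤ r ↔ -(2 * c * y k) ≤ |c| := by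
  have hy2 : ‖y‖ ^ 2 = (n : ℝ) / 4 := by
    rw [hy, div_pow, Real.sq_sqrt (Nat.cast_nonneg n)]
    norm_num
  have key : ‖y - c • EuclideanSpace.single k (1 : ℝ)‖ ^ 2 =
      (n : ℝ) / 4 - 2 * c * y k + |c| ^ 2 := by
    rw [norm_sub_sq_real, hy2, inner_smul_right, EuclideanSpace.inner_single_right, norm_smul,
      PiLp.norm_single]
    simp
    ring
  rw [← sq_le_sq₀ (norm_nonneg _) hr, key, hr2]
  constructor <;> intro h <;> nlinarith

/-- The ball polytope `U_r = ⋂ₖ (B̄(C_{k+}, r) ∩ B̄(C_{k−}, r))` has the same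
intersection with the sphere of center `C` and radius `√n / 2` as the unit hypercube:
on that sphere, `x ∈ U_r` iff `0 ≤ x k ≤ 1` for all `k`. -/
theorem stmt14 {n : ℕ} (hn : 1 ≤ n) (C : EuclideanSpace ℝ (Fin n))
    (hC : ∀ i, C i = 1 / 2) (d r : ℝ) (hd : 0 < d) (hr : 0 < r)
    (hr2 : r ^ 2 = (d + 1 / 2) ^ 2 + ((n : ℝ) - 1) / 4) :
    ∀ x : EuclideanSpace ℝ (Fin n), ‖x - C‖ = Real.sqrt n / 2 →
      (x ∈ ⋂ k : Fin n, (closedBall (C + d • EuclideanSpace.single k 1) r ∩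
          closedBall (C - d • EuclideanSpace.single k 1) r) ↔
        ∀ k : Fin n, 0 ≤ x k ∧ x k ≤ 1) := by
  intro x hx
  rw [Set.mem_iInter]
  refine forall_congr' fun k => ?_
  have hplus := norm_sub_smul_single_le_iff hx k (c := d) hr.le (by rwa [abs_of_pos hd])
  have hminus := norm_sub_smul_single_le_iff hx k (c := -d) hr.le
    (by rwa [abs_neg, abs_of_pos hd])
  rw [abs_of_pos hd] at hplus
  rw [abs_neg, abs_of_pos hd] at hminus
  rw [neg_smul, sub_neg_eq_add] at hminus
  rw [Set.mem_inter_iff, mem_closedBall_iff_norm, mem_closedBall_iff_norm, ← sub_sub,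
    ← sub_add, hplus, hminus, PiLp.sub_apply, hC]
  refine and_congr ⟨fun h => ?_, fun h => ?_⟩ ⟨fun h => ?_, fun h => ?_⟩ <;> nlinarith
end

section
/- Let n ≥ 1, C = (1/2, …, 1/2) ∈ ℝ^n, S ∈ ℝ^n with S ≠ 0, T ∈ ℝ, and let P_s = C − ((⟨S, C⟩ − T)/‖S‖²)·S be the orthogonal projection of C onto the hyperplane {x : ⟨S, x⟩ = T}. Let r > √n/2 and let d_s > 0 satisfy d_s² + (n/4 − ‖C − P_s‖²) = r², where ‖C − P_s‖² ≤ n/4, and set C_s = P_s − (d_s/‖S‖)·S. Then for every x ∈ ℝ^n with ‖x − C‖ = √n/2: ‖x − C_s‖ ≤ r if and only if ⟨S, x⟩ ≤ T. -/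
open scoped RealInnerProductSpace

/-- If `x` has distance `ρ` from `C` and `k` scales `S` so that `C - k • S` lies on the hyperplane
`{x : ⟪S, x⟫ = T}`, then the power of `x` with respect to the sphere of center `C - (k + m) • S`
through the intersection of that hyperplane with the sphere of radius `ρ` about `C` is
`2 * (k + m) * (⟪S, x⟫ - T)`. -/
theorem norm_sub_sub_smul_sq_sub_eq {E : Type*} [NormedAddCommGroup E] [InnerProductSpace ℝ E]
    {C S x : E} {T k m ρ : ℝ} (hk : k * ‖S‖ ^ 2 = ⟪S, C⟫ - T) (hx : ‖x - C‖ = ρ) :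
    ‖x - (C - (k + m) • S)‖ ^ 2 - ((m * ‖S‖) ^ 2 + (ρ ^ 2 - (k * ‖S‖) ^ 2)) =
      2 * (k + m) * (⟪S, x⟫ - T) := by
  have h : x - (C - (k + m) • S) = (x - C) + (k + m) • S := by abel
  rw [h, norm_add_sq_real, hx, norm_smul, mul_pow, Real.norm_eq_abs, sq_abs,
    real_inner_smul_right, real_inner_comm, inner_sub_right]
  linear_combination 2 * (k + m) * hk

/-- With `P_s` the orthogonal projection of the hypercube center `C` onto the hyperplane
`{x : ⟪S, x⟫ = T}` and `C_s = P_s − (d_s/‖S‖) • S` where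
`d_s² + (n/4 − ‖C − P_s‖²) = r²`, a point `x` of the sphere of center `C` and radius
`√n / 2` satisfies `‖x − C_s‖ ≤ r` iff `⟪S, x⟫ ≤ T`. -/
theorem stmt15 {n : ℕ} (hn : 1 ≤ n) (C : EuclideanSpace ℝ (Fin n))
    (hC : ∀ i, C i = 1 / 2)
    (S : EuclideanSpace ℝ (Fin n)) (hS : S ≠ 0) (T : ℝ)
    (Ps : EuclideanSpace ℝ (Fin n))
    (hPs : Ps = C - ((⟪S, C⟫ - T) / ‖S‖ ^ 2) • S)
    (hmeet : ‖C - Ps‖ ^ 2 ≤ (n : ℝ) / 4)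
    (r ds : ℝ) (hr : Real.sqrt n / 2 < r) (hds : 0 < ds)
    (hds2 : ds ^ 2 + ((n : ℝ) / 4 - ‖C - Ps‖ ^ 2) = r ^ 2)
    (Cs : EuclideanSpace ℝ (Fin n)) (hCs : Cs = Ps - (ds / ‖S‖) • S) :
    ∀ x : EuclideanSpace ℝ (Fin n), ‖x - C‖ = Real.sqrt n / 2 →
      (‖x - Cs‖ ≤ r ↔ ⟪S, x⟫ ≤ T) := by
  intro x hx
  have hS0 : 0 < ‖S‖ := norm_pos_iff.mpr hS
  set k := (⟪S, C⟫ - T) / ‖S‖ ^ 2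
  have hk : k * ‖S‖ ^ 2 = ⟪S, C⟫ - T := div_mul_cancel₀ _ (by positivity)
  have hm : ds / ‖S‖ * ‖S‖ = ds := div_mul_cancel₀ _ hS0.ne'
  have hρ : (Real.sqrt n / 2) ^ 2 = (n : ℝ) / 4 := by
    rw [div_pow, Real.sq_sqrt n.cast_nonneg]
    norm_num
  have hr0 : 0 ≤ r := le_trans (by positivity) hr.le
  have hdist : ‖C - Ps‖ ^ 2 = (k * ‖S‖) ^ 2 := by
    rw [hPs, sub_sub_cancel, norm_smul, mul_pow, mul_pow, Real.norm_eq_abs, sq_abs]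
  have hr2 : (n : ℝ) / 4 < r ^ 2 := by
    rw [← hρ]
    exact pow_lt_pow_left₀ hr (by positivity) two_ne_zero
  have hpos : 0 < k + ds / ‖S‖ := by
    refine pos_of_mul_pos_left (b := ‖S‖) ?_ hS0.le
    rw [add_mul, hm]
    linarith [(abs_lt.mp (abs_lt_of_sq_lt_sq (a := k * ‖S‖) (by linarith) hds.le)).1]
  have hCs' : Cs = C - (k + ds / ‖S‖) • S := by
    rw [hCs, hPs, add_smul, sub_sub]
  have key := norm_sub_sub_smul_sq_sub_eq (m := ds / ‖S‖) hk hx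
  rw [← hCs', hm, hρ, ← hdist, hds2] at key
  rw [← sq_le_sq₀ (norm_nonneg _) hr0, ← sub_nonpos, key, ← sub_nonpos (a := ⟪S, x⟫)]
  have hpos2 : 0 < 2 * (k + ds / ‖S‖) := by positivity
  exact ⟨fun h => nonpos_of_mul_nonpos_right h hpos2,
    mul_nonpos_of_nonneg_of_nonpos hpos2.le⟩
end

section
/- Let n ≥ 1, C = (1/2, …, 1/2) ∈ ℝ^n, d > 0 with r² = (d + 1/2)² + (n − 1)/4 and r > √n/2, C_{k±} = C ± d·e_k, and U_r = ⋂_{k=1}^n (B̄(C_{k+}, r) ∩ B̄(C_{k−}, r)). Let S ∈ ℝ^n, S ≠ 0, T ∈ ℝ, let P_s be the orthogonal projection of C onto {x : ⟨S, x⟩ = T}, assume ‖C − P_s‖² ≤ n/4, let d_s > 0 with d_s² + (n/4 − ‖C − P_s‖²) = r², C_s = P_s − (d_s/‖S‖)·S, and Q_r = U_r ∩ B̄(C_s, r). If x* ∈ {0,1}^n satisfies ⟨S, x*⟩ = T, then ‖x* − C‖ = √n/2 and x* ∈ Q_r; in particular every solution of the subset sum problem SSP(S, T) is a corner of Q_r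 lying on the sphere {x : ‖x − C‖ = √n/2}. -/
open Metric
open scoped RealInnerProductSpace

/-- Adding a multiple `c • e_k` to a vector changes its squared norm by `2 c y_k + c ^ 2`. -/
theorem norm_add_smul_single_sq {n : ℕ} (y : EuclideanSpace ℝ (Fin n)) (c : ℝ) (k : Fin n) :
    ‖y + c • EuclideanSpace.single k (1 : ℝ)‖ ^ 2 = ‖y‖ ^ 2 + 2 * c * y k + c ^ 2 := by
  rw [norm_add_sq_real, real_inner_smul_right, norm_smul, EuclideanSpace.inner_single_right]
  simp
  ring

/-- A vertex of the unit cube is at squared distance `n / 4` from the center of the cube. -/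
theorem norm_sub_center_sq {n : ℕ} {C x : EuclideanSpace ℝ (Fin n)}
    (hC : ∀ i, C i = 1 / 2) (hx : ∀ i, x i = 0 ∨ x i = 1) :
    ‖x - C‖ ^ 2 = (n : ℝ) / 4 := by
  have h : ∀ i, ‖(x - C) i‖ ^ 2 = 1 / 4 := fun i => by
    rcases hx i with h | h <;> simp [h, hC] <;> norm_num
  rw [EuclideanSpace.norm_sq_eq, Finset.sum_congr rfl fun i _ => h i]
  simp
  ring

/-- Every solution `x*` of the subset sum problem `SSP(S, T)` lies on the sphere of
center `C` and radius `√n / 2` and is a point of the ball polytope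
`Q_r = U_r ∩ B̄(C_s, r)` associated to `SSP(S, T)`. -/
theorem stmt16 {n : ℕ} (hn : 1 ≤ n) (C : EuclideanSpace ℝ (Fin n))
    (hC : ∀ i, C i = 1 / 2) (d r : ℝ) (hd : 0 < d) (hr : 0 < r)
    (hr2 : r ^ 2 = (d + 1 / 2) ^ 2 + ((n : ℝ) - 1) / 4)
    (S : EuclideanSpace ℝ (Fin n)) (hS : S ≠ 0) (T : ℝ)
    (Ps : EuclideanSpace ℝ (Fin n))
    (hPs : Ps = C - ((⟪S, C⟫ - T) / ‖S‖ ^ 2) • S)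
    (hmeet : ‖C - Ps‖ ^ 2 ≤ (n : ℝ) / 4)
    (ds : ℝ) (hds : 0 < ds)
    (hds2 : ds ^ 2 + ((n : ℝ) / 4 - ‖C - Ps‖ ^ 2) = r ^ 2)
    (Cs : EuclideanSpace ℝ (Fin n)) (hCs : Cs = Ps - (ds / ‖S‖) • S)
    (x : EuclideanSpace ℝ (Fin n))
    (hx01 : ∀ i, x i = 0 ∨ x i = 1) (hxT : ⟪S, x⟫ = T) :
    ‖x - C‖ = Real.sqrt n / 2 ∧
    x ∈ (⋂ k : Fin n, (closedBall (C + d • EuclideanSpace.single k 1) r ∩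
          closedBall (C - d • EuclideanSpace.single k 1) r)) ∩
        closedBall Cs r := by
  have hy := norm_sub_center_sq hC hx01
  have hyk : ∀ k, (x - C) k = -(1 / 2) ∨ (x - C) k = 1 / 2 := fun k => by
    rcases hx01 k with h | h <;> simp [h, hC] <;> norm_num
  refine ⟨?_, Set.mem_iInter.2 fun k => ⟨?_, ?_⟩, ?_⟩
  · rw [← sq_eq_sq₀ (norm_nonneg _) (by positivity), hy, div_pow, Real.sq_sqrt (by positivity)]
    norm_num
  · rw [mem_closedBall, dist_eq_norm, ← sq_le_sq₀ (norm_nonneg _) hr.le,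
      show x - (C + d • EuclideanSpace.single k 1) =
        (x - C) + (-d) • EuclideanSpace.single k (1 : ℝ) by module,
      norm_add_smul_single_sq, hy, hr2]
    rcases hyk k with h | h <;> rw [h] <;> nlinarith
  · rw [mem_closedBall, dist_eq_norm, ← sq_le_sq₀ (norm_nonneg _) hr.le,
      show x - (C - d • EuclideanSpace.single k 1) =
        (x - C) + d • EuclideanSpace.single k (1 : ℝ) by module,
      norm_add_smul_single_sq, hy, hr2]
    rcases hyk k with h | h <;> rw [h] <;> nlinarith
  · have hS0 : ‖S‖ ≠ 0 := norm_ne_zero_iff.2 hS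
    have horth : ⟪S, x - Ps⟫ = 0 := by
      rw [hPs, inner_sub_right, inner_sub_right, real_inner_smul_right,
        real_inner_self_eq_norm_sq, hxT]
      field_simp
      ring
    have hperp : ⟪x - Ps, C - Ps⟫ = 0 := by
      rw [show C - Ps = ((⟪S, C⟫ - T) / ‖S‖ ^ 2) • S by rw [hPs]; module,
        real_inner_smul_right, real_inner_comm S (x - Ps), horth, mul_zero]
    have hdist : ‖x - C‖ ^ 2 = ‖x - Ps‖ ^ 2 + ‖C - Ps‖ ^ 2 := by
      rw [show x - C = (x - Ps) - (C - Ps) by module, norm_sub_sq_real, hperp]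
      ring
    have hcenter : ‖x - Cs‖ ^ 2 = ‖x - Ps‖ ^ 2 + ds ^ 2 := by
      rw [show x - Cs = (x - Ps) + (ds / ‖S‖) • S by rw [hCs]; module, norm_add_sq_real,
        real_inner_smul_right, real_inner_comm S (x - Ps), horth, norm_smul, mul_pow, Real.norm_eq_abs,
        sq_abs]
      field_simp
      ring
    rw [mem_closedBall, dist_eq_norm, ← sq_le_sq₀ (norm_nonneg _) hr.le]
    linarith
end
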